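/- Let G be a group with a seminorm ‖·‖ and let g ∈ G. Suppose q : ⟨g⟩ → ℝ is an unbounded quasimorphism on the cyclic group generated by g satisfying |q(gⁿ)| ≤ ‖gⁿ‖ for all n. Then for every finitely generated subgroup Γ ≤ G containing g, the translation length of g in Γ is positive; i.e. g is undistorted in G. -/

import Mathlib

open Filter

noncomputable def wordNorm {G : Type*} [Group G] (S : Set G) (g : G) : ℕ :=
  sInf {n | ∃ l : List G, l.length = n ∧ (∀ x ∈ l, x ∈ S ∨ x⁻¹ ∈ S) ∧ l.prod = g}

theorem wordNorm_spec_aux {G : Type*} [Group G] (S : Set G) (g : G)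
    (hg : g ∈ Subgroup.closure S) :
    ∃ l : List G, l.length = wordNorm S g ∧ (∀ x ∈ l, x ∈ S ∨ x⁻¹ ∈ S) ∧ l.prod = g := by
  rw [← Subgroup.mem_toSubmonoid, Subgroup.closure_toSubmonoid] at hg
  obtain ⟨l, hl, hp⟩ := Submonoid.exists_list_of_mem_closure hg
  exact Nat.sInf_mem (s := {n | ∃ l : List G, l.length = n ∧
    (∀ x ∈ l, x ∈ S ∨ x⁻¹ ∈ S) ∧ l.prod = g}) ⟨l.length, l, rfl, hl, hp⟩

theorem wordNorm_mul_aux {G : Type*} [Group G] (S : Set G) (g h : G)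
    (hg : g ∈ Subgroup.closure S) (hh : h ∈ Subgroup.closure S) :
    wordNorm S (g * h) ≤ wordNorm S g + wordNorm S h := by
  obtain ⟨l, hl, hS, hp⟩ := wordNorm_spec_aux S g hg
  obtain ⟨l', hl', hS', hp'⟩ := wordNorm_spec_aux S h hh
  refine Nat.sInf_le ⟨l ++ l', by simp [hl, hl'], ?_, by simp [hp, hp']⟩
  intro x hx
  rcases List.mem_append.1 hx with hx | hx
  · exact hS x hx
  · exact hS' x hx

theorem norm_list_aux {G : Type*} [Group G] (N : G → ℝ)
    (htri : ∀ g h : G, N (g * h) ≤ N g + N h) (C : ℝ) (l : List G)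
    (hl : ∀ x ∈ l, N x ≤ C) : N l.prod ≤ C * l.length + N 1 := by
  induction l with
  | nil => simp
  | cons a l ih =>
    have h1 := ih (fun x hx => hl x (List.mem_cons_of_mem _ hx))
    have h2 := hl a List.mem_cons_self
    have h3 := htri a l.prod
    simp only [List.prod_cons, List.length_cons]
    push_cast
    linarith

theorem quasi_aux (q : ℤ → ℝ) (D : ℝ) (hD : ∀ m n : ℤ, |q m - q (m + n) + q n| ≤ D)
    (k : ℤ) (m : ℕ) : |q (k * ((m : ℤ) + 1)) - (m + 1) * q k| ≤ m * D := by
  induction m with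
  | zero => simp
  | succ m ih =>
    have h := hD (k * ((m : ℤ) + 1)) k
    have e : k * (((m + 1 : ℕ) : ℤ) + 1) = k * ((m : ℤ) + 1) + k := by push_cast; ring
    rw [e]
    push_cast
    rw [abs_le] at *
    constructor <;> linarith [h.1, h.2, ih.1, ih.2]

/-- The quasimorphism `q` on the cyclic group `⟨g⟩` is modelled as a function on
`ℤ`, with `q n` playing the role of `q(gⁿ)`. -/
theorem stmt_11 {G : Type*} [Group G] (N : G → ℝ)
    (hsymm : ∀ g : G, N g⁻¹ = N g)
    (htri : ∀ g h : G, N (g * h) ≤ N g + N h)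
    (g : G) (q : ℤ → ℝ)
    (hdefect : ∃ D : ℝ, ∀ m n : ℤ, |q m - q (m + n) + q n| ≤ D)
    (hunbdd : ¬ ∃ M : ℝ, ∀ n : ℤ, |q n| ≤ M)
    (hLip : ∀ n : ℤ, |q n| ≤ N (g ^ n)) :
    ∀ S : Finset G, g ∈ Subgroup.closure (S : Set G) →
      ∃ τ : ℝ, 0 < τ ∧
        Tendsto (fun n : ℕ => (wordNorm (S : Set G) (g ^ n) : ℝ) / n)
          atTop (nhds τ) := by
  intro S hg
  obtain ⟨D, hD⟩ := hdefect
  have hN1 : 0 ≤ N 1 := by have := htri 1 1; simp only [mul_one] at this; linarith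
  have hN : ∀ x, 0 ≤ N x := by
    intro x
    have := htri x x⁻¹
    rw [mul_inv_cancel, hsymm] at this
    linarith
  have hq0 : |q 0| ≤ D := by simpa using hD 0 0
  have hD0 : 0 ≤ D := (abs_nonneg _).trans hq0
  -- a positive integer with a large value of `q`
  obtain ⟨k, hk0, hk⟩ : ∃ k : ℕ, 0 < k ∧ D + N 1 < |q k| := by
    push Not at hunbdd
    obtain ⟨j, hj⟩ := hunbdd (3 * D + N 1)
    have hneg : 3 * D + N 1 < |q j| → D + N 1 < |q (-j)| := by
      intro h
      have h1 := hD j (-j)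
      rw [add_neg_cancel] at h1
      have h2 : |q j| ≤ |q j - q 0 + q (-j)| + |q 0| + |q (-j)| := by
        have e : q j = (q j - q 0 + q (-j)) + q 0 - q (-j) := by ring
        calc |q j| = |(q j - q 0 + q (-j)) + q 0 - q (-j)| := by rw [← e]
          _ ≤ |(q j - q 0 + q (-j)) + q 0| + |q (-j)| := abs_sub _ _
          _ ≤ _ := by gcongr; exact abs_add_le _ _
      linarith
    have hj0 : j ≠ 0 := by
      rintro rfl
      linarith
    rcases Int.natAbs_eq j with h | h
    · refine ⟨j.natAbs, Int.natAbs_pos.2 hj0, ?_⟩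
      rw [← h]; linarith
    · refine ⟨j.natAbs, Int.natAbs_pos.2 hj0, ?_⟩
      have hnat : (j.natAbs : ℤ) = -j := by omega
      rw [hnat]; exact hneg hj
  -- bound on the generators
  obtain ⟨C, hC0, hC⟩ : ∃ C : ℝ, 0 < C ∧ ∀ x ∈ S, N x ≤ C := by
    refine ⟨1 + ∑ x ∈ S, N x, ?_, ?_⟩
    · have := Finset.sum_nonneg (fun x (_ : x ∈ S) => hN x)
      linarith
    · intro x hx
      have := Finset.single_le_sum (fun x (_ : x ∈ S) => hN x) hx
      linarith
  have hW : ∀ x ∈ Subgroup.closure (S : Set G), N x ≤ C * wordNorm (S : Set G) x + N 1 := by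
    intro x hx
    obtain ⟨l, hl, hS, hp⟩ := wordNorm_spec_aux (S : Set G) x hx
    have := norm_list_aux N htri C l (fun y hy => by
      rcases hS y hy with h | h
      · exact hC y h
      · rw [← hsymm]; exact hC _ h)
    rwa [hl, hp] at this
  have hsub : Subadditive (fun n : ℕ => (wordNorm (S : Set G) (g ^ n) : ℝ)) := by
    intro m n
    have := wordNorm_mul_aux (S : Set G) (g ^ m) (g ^ n) (pow_mem hg m) (pow_mem hg n)
    rw [← pow_add] at this
    beta_reduce
    exact_mod_cast this
  have hlim := hsub.tendsto_lim ⟨0, by rintro _ ⟨n, rfl⟩; positivity⟩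
  refine ⟨hsub.lim, ?_, hlim⟩
  have hkR : (0 : ℝ) < k := by exact_mod_cast hk0
  have hc : 0 < (|q k| - D - N 1) / (C * k) := div_pos (by linarith) (by positivity)
  refine hc.trans_le ?_
  have hφ : Tendsto (fun m : ℕ => k * (m + 1)) atTop atTop :=
    tendsto_atTop_mono (fun m => by simp only [id]; nlinarith) tendsto_id
  refine ge_of_tendsto (hlim.comp hφ) (Eventually.of_forall fun m => ?_)
  have h1 := quasi_aux q D hD k m
  have h2 := hLip (k * ((m : ℤ) + 1))
  have h3 := hW (g ^ (k * (m + 1))) (pow_mem hg _)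
  have e : g ^ ((k : ℤ) * ((m : ℤ) + 1)) = g ^ (k * (m + 1)) := by
    rw [← zpow_natCast]; push_cast; rfl
  rw [e] at h2
  have h4 : ((m : ℝ) + 1) * |q k| - |q (k * ((m : ℤ) + 1))| ≤ m * D := by
    have := abs_sub_abs_le_abs_sub (((m : ℝ) + 1) * q k) (q (k * ((m : ℤ) + 1)))
    rw [abs_mul, abs_of_pos (by positivity : (0 : ℝ) < m + 1), abs_sub_comm] at this
    linarith
  have hm : (0 : ℝ) ≤ m := Nat.cast_nonneg m
  have h5 : 0 ≤ m * N 1 := by positivity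
  simp only [Function.comp]
  push_cast
  rw [div_le_div_iff₀ (by positivity) (by positivity)]
  have h6 : (|q k| - D - N 1) * (m + 1) ≤ C * wordNorm (S : Set G) (g ^ (k * (m + 1))) := by
    linarith
  have := mul_le_mul_of_nonneg_right h6 hkR.le
  linarith
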